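/- Let a be a nonzero complex number, let Z = {ρ ∈ ℂ : sin(ρ) − ρ − a = 0} be the zero set of the entire function f(z) = sin(z) − z − a, and for ρ ∈ Z let k_ρ be the order of the zero of f at ρ. Then the series ∑_{ρ∈Z} k_ρ/ρ² converges absolutely and its sum is 0. -/

import Mathlib

open Complex

lemma aux_extract {h : ℂ → ℂ} (hh : Differentiable ℂ h) {ρ : ℂ} (hρ : ρ ≠ 0) {n : ℕ}
    (hn : analyticOrderAt h ρ = n) :
    ∃ g : ℂ → ℂ, Differentiable ℂ g ∧ g ρ ≠ 0 ∧ ∀ z, h z = (1 - z / ρ) ^ n * g z := by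
  obtain ⟨u, hu, hu0, hev⟩ := ((hh.analyticAt ρ).analyticOrderAt_eq_natCast).1 hn
  classical
  set g0 : ℂ → ℂ := Function.update (fun z => h z / (z - ρ) ^ n) ρ (u ρ) with hg0
  have e1 : g0 =ᶠ[nhds ρ] u := by
    filter_upwards [hev] with z hz
    by_cases hzρ : z = ρ
    · subst hzρ; simp [hg0]
    · have : z - ρ ≠ 0 := sub_ne_zero.2 hzρ
      simp [hg0, hzρ, hz]
      field_simp
  have d0 : Differentiable ℂ g0 := by
    intro z
    by_cases hzρ : z = ρ
    · subst hzρ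
      exact (hu.congr e1.symm).differentiableAt
    · have : g0 =ᶠ[nhds z] fun z => h z / (z - ρ) ^ n := by
        filter_upwards [isOpen_ne.mem_nhds hzρ] with w hw
        have hw' : w ≠ ρ := hw
        simp [hg0, hw']
      refine DifferentiableAt.congr_of_eventuallyEq ?_ this
      have : (z - ρ) ^ n ≠ 0 := pow_ne_zero _ (sub_ne_zero.2 hzρ)
      exact (hh z).div (by fun_prop) this
  refine ⟨fun z => (-ρ) ^ n * g0 z, by fun_prop, ?_, fun z => ?_⟩
  · simp [hg0, hρ, hu0]
  · rw [← mul_assoc, ← mul_pow]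
    have e : (1 - z / ρ) * (-ρ) = z - ρ := by field_simp; ring
    rw [e]
    by_cases hzρ : z = ρ
    · subst hzρ
      simpa [hg0] using hev.self_of_nhds
    · have : z - ρ ≠ 0 := sub_ne_zero.2 hzρ
      simp [hg0, hzρ]
      field_simp

lemma aux_factor {F : ℂ → ℂ} (hF : Differentiable ℂ F) (k : ℂ → ℕ) (S : Finset ℂ)
    (hS : ∀ ρ ∈ S, ρ ≠ 0 ∧ analyticOrderAt F ρ = k ρ) :
    ∃ g : ℂ → ℂ, Differentiable ℂ g ∧ (∀ ρ ∈ S, g ρ ≠ 0) ∧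
      ∀ z, F z = (∏ ρ ∈ S, (1 - z / ρ) ^ k ρ) * g z := by
  classical
  induction S using Finset.induction_on with
  | empty => exact ⟨F, hF, by simp, by simp⟩
  | insert ρ S hρ ih =>
    obtain ⟨g, hg, hgS, hfac⟩ := ih (fun σ hσ => hS σ (Finset.mem_insert_of_mem hσ))
    obtain ⟨hρ0, hord⟩ := hS ρ (Finset.mem_insert_self _ _)
    have hP : Differentiable ℂ (fun z => ∏ σ ∈ S, (1 - z / σ) ^ k σ) := by fun_prop
    have hP0 : (∏ σ ∈ S, (1 - ρ / σ) ^ k σ) ≠ 0 := by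
      refine Finset.prod_ne_zero_iff.2 fun σ hσ => pow_ne_zero _ ?_
      have h0 := (hS σ (Finset.mem_insert_of_mem hσ)).1
      rw [sub_ne_zero]
      intro h
      rw [eq_div_iff h0, one_mul] at h
      exact hρ (h ▸ hσ)
    have hFe : F = (fun z => ∏ σ ∈ S, (1 - z / σ) ^ k σ) * g := funext hfac
    rw [hFe, analyticOrderAt_mul (hP.analyticAt _) (hg.analyticAt _),
      ((hP.analyticAt ρ).analyticOrderAt_eq_zero).2 hP0, zero_add] at hord
    obtain ⟨u, hu, hu0, hgu⟩ := aux_extract hg hρ0 hord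
    refine ⟨u, hu, ?_, fun z => ?_⟩
    · intro σ hσ
      rcases Finset.mem_insert.1 hσ with rfl | hσ
      · exact hu0
      · intro h
        exact hgS σ hσ (by rw [hgu, h, mul_zero])
    · rw [Finset.prod_insert hρ, hfac, hgu]; ring

lemma aux_max {g : ℂ → ℂ} (hg : Differentiable ℂ g) {R M : ℝ} (hR : 0 < R)
    (hM : ∀ z, ‖z‖ = R → ‖g z‖ ≤ M) {z : ℂ} (hz : ‖z‖ ≤ R) : ‖g z‖ ≤ M := by
  refine Complex.norm_le_of_forall_mem_frontier_norm_le (U := Metric.ball 0 R) Metric.isBounded_ball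
    hg.diffContOnCl ?_ ?_
  · intro w hw
    rw [frontier_ball _ hR.ne'] at hw
    exact hM w (by simpa using hw)
  · rw [closure_ball _ hR.ne']; simpa using hz

lemma aux_norm_factor {z ρ : ℂ} {R c : ℝ} (hρ : ρ ≠ 0) (h : ‖ρ‖ ≤ R) (hc : 0 ≤ c)
    (hz : ‖z‖ = (c + 1) * R) : c ≤ ‖1 - z / ρ‖ := by
  have h1 : c + 1 ≤ ‖z / ρ‖ := by
    have : 0 < ‖ρ‖ := norm_pos_iff.2 hρ
    rw [norm_div, le_div_iff₀ this, hz]; gcongr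
  have := norm_sub_norm_le (z / ρ) 1
  rw [norm_one, norm_sub_rev] at this
  linarith

lemma aux_count {F : ℂ → ℂ} (hF : Differentiable ℂ F) (k : ℂ → ℕ) (S : Finset ℂ)
    (hS : ∀ ρ ∈ S, ρ ≠ 0 ∧ analyticOrderAt F ρ = k ρ) {R A : ℝ} (hR : 0 < R)
    (hSR : ∀ ρ ∈ S, ‖ρ‖ ≤ R) (hA : ∀ z, ‖F z‖ ≤ A * Real.exp ‖z‖) :
    2 ^ (∑ ρ ∈ S, k ρ) * ‖F 0‖ ≤ A * Real.exp (3 * R) := by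
  obtain ⟨g, hg, -, hfac⟩ := aux_factor hF k S hS
  have h0 : F 0 = g 0 := by simpa using hfac 0
  have hm : ‖g 0‖ ≤ A * Real.exp (3 * R) / 2 ^ (∑ ρ ∈ S, k ρ) := by
    refine aux_max hg (R := 3 * R) (by positivity) (fun z hz => ?_) (by simp; positivity)
    rw [le_div_iff₀ (by positivity)]
    have := hA z
    rw [hfac, norm_mul, norm_prod, hz] at this
    refine le_trans ?_ this
    rw [mul_comm, ← Finset.prod_pow_eq_pow_sum]
    gcongr with ρ hρ
    rw [norm_pow]
    gcongr
    exact aux_norm_factor (hS ρ hρ).1 (hSR ρ hρ) (by norm_num) (by rw [hz]; norm_num)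
  rw [h0, mul_comm]
  rwa [le_div_iff₀ (by positivity)] at hm

lemma aux_log {g : ℂ → ℂ} (hg : Differentiable ℂ g) {R : ℝ} (hR : 0 < R)
    (hg0 : ∀ z, ‖z‖ < R → g z ≠ 0) :
    ∃ h : ℂ → ℂ, h 0 = 0 ∧ (∀ z ∈ Metric.ball (0:ℂ) R, HasDerivAt h (logDeriv g z) z) ∧
      ∀ z ∈ Metric.ball (0:ℂ) R, g z = g 0 * exp (h z) := by
  have hd : DifferentiableOn ℂ (logDeriv g) (Metric.ball 0 R) := by
    intro z hz
    have h1 : DifferentiableAt ℂ (deriv g) z := ((hg.analyticAt z).deriv).differentiableAt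
    exact (h1.div (hg z) (hg0 z (by simpa using hz))).differentiableWithinAt
  obtain ⟨h, h0, hh⟩ := hd.isExactOn_ball.with_val_at 0 0
  refine ⟨h, h0, hh, fun z hz => ?_⟩
  have key : ∀ z ∈ Metric.ball (0:ℂ) R, HasDerivAt (fun z => g z * exp (-h z)) 0 z := by
    intro w hw
    have := (hg w).hasDerivAt.mul ((hh w hw).neg.cexp)
    refine this.congr_deriv ?_
    have : g w ≠ 0 := hg0 w (by simpa using hw)
    simp only [logDeriv_apply]
    field_simp; ring
  have := (convex_ball (0:ℂ) R).is_const_of_fderivWithin_eq_zero (𝕜 := ℂ)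
    (f := fun z => g z * exp (-h z))
    (fun w hw => (key w hw).differentiableAt.differentiableWithinAt) (fun w hw => by
      rw [fderivWithin_of_isOpen Metric.isOpen_ball hw]
      ext; simp [(key w hw).deriv]) hz (Metric.mem_ball_self hR)
  simp only [h0, neg_zero, exp_zero, mul_one] at this
  rw [← this, mul_assoc, ← exp_add]; simp

lemma aux_second {F : ℂ → ℂ} (hF : Differentiable ℂ F) (k : ℂ → ℕ) (S : Finset ℂ)
    (hS : ∀ ρ ∈ S, ρ ≠ 0 ∧ analyticOrderAt F ρ = k ρ) {R A : ℝ} (hR : 0 < R)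
    (hSR : ∀ ρ ∈ S, ‖ρ‖ ≤ R) (hSall : ∀ ρ, F ρ = 0 → ‖ρ‖ ≤ R → ρ ∈ S)
    (hA : ∀ z, ‖F z‖ ≤ A * Real.exp ‖z‖) (hF0 : F 0 ≠ 0)
    (hF2 : deriv (logDeriv F) 0 = 0) :
    ‖∑ ρ ∈ S, (k ρ : ℂ) / ρ ^ 2‖ ≤ 16 * (2 * R + |Real.log (A / ‖F 0‖)|) / R ^ 2 := by
  obtain ⟨g, hg, hgS, hfac⟩ := aux_factor hF k S hS
  have h0 : F 0 = g 0 := by simpa using hfac 0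
  have hFpos : 0 < ‖F 0‖ := norm_pos_iff.2 hF0
  have hApos : 0 < A := by
    have := hA 0
    simp at this
    linarith
  have hgne : ∀ z, ‖z‖ < R → g z ≠ 0 := by
    intro z hz hgz
    have : F z = 0 := by rw [hfac, hgz, mul_zero]
    exact hgS z (hSall z this hz.le) hgz
  have hm : ∀ z, ‖z‖ ≤ 2 * R → ‖g z‖ ≤ A * Real.exp (2 * R) := by
    intro z hz
    refine aux_max hg (R := 2 * R) (by positivity) (fun z hz => ?_) hz
    have := hA z
    rw [hfac, norm_mul, norm_prod, hz] at this
    refine le_trans ?_ this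
    refine le_mul_of_one_le_left (norm_nonneg _) ?_
    rw [← Finset.prod_const_one (s := S)]
    refine Finset.prod_le_prod (fun _ _ => zero_le_one) fun ρ hρ => ?_
    rw [norm_pow]
    exact one_le_pow₀ (aux_norm_factor (hS ρ hρ).1 (hSR ρ hρ) (by norm_num) (by rw [hz]; norm_num))
  obtain ⟨h, hh0, hhd, hhe⟩ := aux_log hg hR hgne
  set M : ℝ := 2 * R + |Real.log (A / ‖F 0‖)| with hM
  have hMpos : 0 < M := by positivity
  have hre : Set.MapsTo h (Metric.ball 0 R) {z | z.re ≤ M} := by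
    intro z hz
    have h1 := hm z (by have : ‖z‖ < R := by simpa using hz
                        linarith)
    rw [hhe z hz, ← h0, norm_mul, norm_exp] at h1
    have h2 : Real.exp (h z).re ≤ A / ‖F 0‖ * Real.exp (2 * R) := by
      rw [div_mul_eq_mul_div, le_div_iff₀ hFpos]; linarith
    have h3 := Real.log_le_log (Real.exp_pos _) h2
    rw [Real.log_exp, Real.log_mul (by positivity) (by positivity), Real.log_exp] at h3
    have := le_abs_self (Real.log (A / ‖F 0‖))
    show (h z).re ≤ M
    linarith
  have hdo : DifferentiableOn ℂ h (Metric.ball 0 R) := fun z hz =>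
    (hhd z hz).differentiableAt.differentiableWithinAt
  have hbd : ∀ z ∈ Metric.sphere (0:ℂ) (R / 2), ‖h z‖ ≤ 2 * M := by
    intro z hz
    have hz' : ‖z‖ = R / 2 := by simpa using hz
    have := borelCaratheodory_zero hMpos hdo hre hR (z := z) (by simp [hz']; linarith) hh0
    rw [hz'] at this
    refine this.trans (le_of_eq ?_)
    field_simp; ring
  have hcl : DiffContOnCl ℂ h (Metric.ball 0 (R / 2)) := by
    refine DifferentiableOn.diffContOnCl ?_
    refine hdo.mono ?_
    rw [closure_ball _ (by positivity)]
    exact Metric.closedBall_subset_ball (by linarith)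
  have hC := norm_iteratedDeriv_le_of_forall_mem_sphere_norm_le 2 (by positivity) hcl hbd
  have hid : iteratedDeriv 2 h 0 = deriv (logDeriv g) 0 := by
    rw [iteratedDeriv_succ, iteratedDeriv_one]
    refine Filter.EventuallyEq.deriv_eq ?_
    filter_upwards [Metric.ball_mem_nhds (0:ℂ) hR] with z hz
    exact (hhd z hz).deriv
  have hgd : deriv (logDeriv g) 0 = ∑ ρ ∈ S, (k ρ : ℂ) / ρ ^ 2 := by
    have e : logDeriv g =ᶠ[nhds 0] fun z => logDeriv F z - ∑ ρ ∈ S, (k ρ : ℂ) / (z - ρ) := by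
      filter_upwards [hF.continuous.continuousAt.eventually_ne hF0] with z hz
      have hz2 := hz
      rw [hfac, mul_ne_zero_iff] at hz2
      have hz3 := Finset.prod_ne_zero_iff.1 hz2.1
      rw [show F = fun z => (∏ ρ ∈ S, (1 - z / ρ) ^ k ρ) * g z from funext hfac,
        logDeriv_mul z hz2.1 hz2.2 (by fun_prop) (hg z),
        logDeriv_prod (f := fun ρ z => (1 - z / ρ) ^ k ρ) hz3 (by fun_prop), eq_sub_iff_add_eq,
        add_comm]
      congr 1
      refine Finset.sum_congr rfl fun ρ hρ => ?_
      rw [logDeriv_fun_pow (f := fun z => 1 - z / ρ) (by fun_prop)]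
      have hρ0 := (hS ρ hρ).1
      have hd1 : deriv (fun z : ℂ => 1 - z / ρ) z = -(1 / ρ) := by
        simp
      rw [logDeriv_apply, hd1]
      by_cases hzρ : z = ρ
      · subst hzρ; simp [hρ0]
      · have h1 : z - ρ ≠ 0 := sub_ne_zero.2 hzρ
        have h2 : 1 - z / ρ = -(z - ρ) / ρ := by field_simp; ring
        rw [h2]
        field_simp
    rw [e.deriv_eq]
    have hdF : DifferentiableAt ℂ (logDeriv F) 0 :=
      ((hF.analyticAt 0).deriv.differentiableAt).div (hF 0) hF0
    have hsum : HasDerivAt (fun z : ℂ => ∑ ρ ∈ S, (k ρ : ℂ) / (z - ρ))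
        (∑ ρ ∈ S, -((k ρ : ℂ) / ρ ^ 2)) 0 := by
      refine HasDerivAt.fun_sum fun ρ hρ => ?_
      have hρ0 := (hS ρ hρ).1
      have := (hasDerivAt_const (0:ℂ) (k ρ : ℂ)).div ((hasDerivAt_id (0:ℂ)).sub_const ρ)
        (by simpa using hρ0)
      refine this.congr_deriv ?_
      simp [neg_div]
    have := (hdF.hasDerivAt.fun_sub hsum).deriv
    rw [hF2] at this
    simpa using this
  rw [hid, hgd] at hC
  refine hC.trans (le_of_eq ?_)
  simp [Nat.factorial]
  field_simp; norm_num

lemma aux_summable {ι : Type*} (κ r : ι → ℝ) (hκ : ∀ i, 0 ≤ κ i) {δ C : ℝ} (hδ : 0 < δ)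
    (hr : ∀ i, δ ≤ r i) (hC : 0 ≤ C)
    (h : ∀ (S : Finset ι) (R : ℝ), 0 < R → (∀ i ∈ S, r i ≤ R) → ∑ i ∈ S, κ i ≤ C * (R + 1)) :
    Summable (fun i => κ i / r i ^ 2) := by
  classical
  have hex : ∀ i, ∃ j : ℕ, r i ≤ δ * 2 ^ j := by
    intro i
    obtain ⟨j, hj⟩ := pow_unbounded_of_one_lt (r i / δ) (one_lt_two)
    exact ⟨j, by rw [div_lt_iff₀ hδ] at hj; linarith⟩
  have hpt : ∀ i, κ i / r i ^ 2 ≤ 4 / δ ^ 2 * (κ i * (1 / 4) ^ (Nat.find (hex i))) := by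
    intro i
    have hri : 0 < r i := hδ.trans_le (hr i)
    have : 1 / r i ^ 2 ≤ 4 / δ ^ 2 * (1 / 4) ^ (Nat.find (hex i)) := by
      rcases hj : Nat.find (hex i) with _ | j
      · have h1 : 1 / r i ^ 2 ≤ 1 / δ ^ 2 := by gcongr; exact hr i
        have h2 : 1 / δ ^ 2 ≤ 4 / δ ^ 2 := by gcongr; norm_num
        simpa using h1.trans h2
      · have h1 : δ * 2 ^ j < r i := by
          have := Nat.find_min (hex i) (m := j) (by omega)
          simpa using this
        have h2 : 1 / r i ^ 2 ≤ 1 / (δ * 2 ^ j) ^ 2 := by gcongr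
        refine h2.trans (le_of_eq ?_)
        rw [mul_pow, ← pow_mul, mul_comm j 2, pow_mul, one_div_pow, pow_succ]
        norm_num
        field_simp
        ring
    calc κ i / r i ^ 2 = κ i * (1 / r i ^ 2) := by ring
      _ ≤ κ i * (4 / δ ^ 2 * (1 / 4) ^ (Nat.find (hex i))) := by gcongr; exact hκ i
      _ = _ := by ring
  refine summable_of_sum_le (c := 4 / δ ^ 2 * (C * (δ + 1) * 2)) (fun i => by have := hκ i; positivity) fun S => ?_
  refine (Finset.sum_le_sum fun i _ => hpt i).trans ?_
  rw [← Finset.mul_sum]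
  gcongr
  set J := S.sup (fun i => Nat.find (hex i)) with hJ
  have hmaps : ∀ i ∈ S, Nat.find (hex i) ∈ Finset.range (J + 1) := fun i hi => by
    rw [Finset.mem_range, Nat.lt_succ_iff]
    exact Finset.le_sup (f := fun i => Nat.find (hex i)) hi
  rw [← Finset.sum_fiberwise_of_maps_to hmaps]
  have hstep : ∀ j ∈ Finset.range (J + 1),
      ∑ i ∈ S with Nat.find (hex i) = j, κ i * (1 / 4 : ℝ) ^ (Nat.find (hex i))
        ≤ C * (δ + 1) * (1 / 2) ^ j := by
    intro j _
    have e : ∑ i ∈ S with Nat.find (hex i) = j, κ i * (1 / 4 : ℝ) ^ (Nat.find (hex i))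
        = (∑ i ∈ S with Nat.find (hex i) = j, κ i) * (1 / 4 : ℝ) ^ j := by
      rw [Finset.sum_mul]
      refine Finset.sum_congr rfl fun i hi => ?_
      rw [(Finset.mem_filter.1 hi).2]
    rw [e]
    have h1 := h (S.filter (fun i => Nat.find (hex i) = j)) (δ * 2 ^ j) (by positivity)
      (fun i hi => by
        have := Nat.find_spec (hex i)
        rwa [(Finset.mem_filter.1 hi).2] at this)
    have h2 : (1:ℝ) ≤ 2 ^ j := one_le_pow₀ (by norm_num)
    calc _ ≤ C * (δ * 2 ^ j + 1) * (1 / 4 : ℝ) ^ j := by gcongr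
      _ ≤ C * (δ * 2 ^ j + 2 ^ j) * (1 / 4 : ℝ) ^ j := by gcongr
      _ = C * (δ + 1) * (2 * (1 / 4)) ^ j := by rw [mul_pow]; ring
      _ = _ := by norm_num
  refine (Finset.sum_le_sum hstep).trans ?_
  rw [← Finset.mul_sum]
  gcongr
  exact (Summable.sum_le_tsum _ (fun _ _ => by positivity) summable_geometric_two).trans_eq
    tsum_geometric_two

/-- For nonzero complex `a`, the zeros `ρ` of `sin z - z - a`, counted with
multiplicity `k_ρ`, satisfy `∑_ρ k_ρ/ρ² = 0` (with absolute convergence). -/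
theorem sum_inv_sq_zeros_sin_sub_id_sub_const (a : ℂ) (ha : a ≠ 0) (k : ℂ → ℕ)
    (hk : ∀ ρ : ℂ, Complex.sin ρ - ρ - a = 0 →
      ∃ h : AnalyticAt ℂ (fun z => Complex.sin z - z - a) ρ,
        analyticOrderAt (fun z => Complex.sin z - z - a) ρ = (k ρ : ℕ∞)) :
    Summable (fun ρ : {ρ : ℂ // Complex.sin ρ - ρ - a = 0} => (k ρ : ℂ) / (ρ : ℂ) ^ 2) ∧
    ∑' ρ : {ρ : ℂ // Complex.sin ρ - ρ - a = 0}, (k ρ : ℂ) / (ρ : ℂ) ^ 2 = 0 := by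
  classical
  set F : ℂ → ℂ := fun z => Complex.sin z - z - a with hFdef
  have hF : Differentiable ℂ F := by fun_prop
  have hF0 : F 0 ≠ 0 := by simpa [hFdef] using ha
  have hFpos : 0 < ‖F 0‖ := norm_pos_iff.2 hF0
  set A : ℝ := 2 + ‖a‖ with hAdef
  have hApos : 0 < A := by positivity
  have hA : ∀ z, ‖F z‖ ≤ A * Real.exp ‖z‖ := by
    intro z
    have h1 : ‖Complex.sin z‖ ≤ Real.exp ‖z‖ := by
      have e1 : ‖exp (-z * I)‖ ≤ Real.exp ‖z‖ := by
        refine (norm_exp_le_exp_norm _).trans (by simp)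
      have e2 : ‖exp (z * I)‖ ≤ Real.exp ‖z‖ := by
        refine (norm_exp_le_exp_norm _).trans (by simp)
      have e3 := norm_sub_le (exp (-z * I)) (exp (z * I))
      rw [Complex.sin, norm_div, norm_mul]
      simp only [norm_I, mul_one, Complex.norm_ofNat]
      linarith
    have h2 : ‖z‖ ≤ Real.exp ‖z‖ := by linarith [Real.add_one_le_exp ‖z‖]
    have h3 : 1 ≤ Real.exp ‖z‖ := Real.one_le_exp (norm_nonneg _)
    have h4 := norm_sub_le (Complex.sin z - z) a
    have h5 := norm_sub_le (Complex.sin z) z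
    have h6 : ‖a‖ ≤ ‖a‖ * Real.exp ‖z‖ := le_mul_of_one_le_right (norm_nonneg _) h3
    simp only [hFdef, hAdef]
    linarith
  have hdF : ∀ z, deriv F z = Complex.cos z - 1 := fun z =>
    (((Complex.hasDerivAt_sin z).sub (hasDerivAt_id z)).sub_const a).deriv
  have hF2 : deriv (logDeriv F) 0 = 0 := by
    have e : logDeriv F = fun z => (Complex.cos z - 1) / F z := by
      funext z; rw [logDeriv_apply, hdF]
    rw [e]
    have := (((Complex.hasDerivAt_cos 0).sub_const 1).div (hF 0).hasDerivAt hF0).deriv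
    refine this.trans ?_
    rw [hdF]; simp
  have hSub : ∀ S : Finset {ρ : ℂ // Complex.sin ρ - ρ - a = 0},
      ∀ ρ ∈ S.map (Function.Embedding.subtype _), ρ ≠ 0 ∧ analyticOrderAt F ρ = k ρ := by
    intro S ρ hρ
    simp only [Finset.mem_map, Function.Embedding.subtype_apply] at hρ
    obtain ⟨σ, -, rfl⟩ := hρ
    refine ⟨fun h => hF0 ?_, (hk σ σ.2).2⟩
    have h1 : F σ = 0 := σ.2
    rwa [h] at h1
  set L : ℝ := |Real.log (A / ‖F 0‖)| with hL
  have hcount : ∀ (S : Finset {ρ : ℂ // Complex.sin ρ - ρ - a = 0}) (R : ℝ), 0 < R →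
      (∀ i ∈ S, ‖(i : ℂ)‖ ≤ R) → ∑ i ∈ S, (k i : ℝ) ≤ (6 + 2 * L) * (R + 1) := by
    intro S R hR hSR
    have h1 := aux_count hF k (S.map (Function.Embedding.subtype _)) (hSub S) hR
      (by simpa using fun x hx hx' => hSR ⟨x, hx⟩ hx') hA
    rw [Finset.sum_map, ← le_div_iff₀ hFpos] at h1
    have h2 := Real.log_le_log (by positivity) h1
    rw [Real.log_pow, mul_div_right_comm, Real.log_mul (by positivity) (by positivity),
      Real.log_exp] at h2
    push_cast at h2
    simp only [Function.Embedding.subtype_apply] at h2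
    have h3 := Real.log_two_gt_d9
    have h4 : 0 ≤ ∑ i ∈ S, (k i : ℝ) := by positivity
    have h5 := le_abs_self (Real.log (A / ‖F 0‖))
    have h6 : 0 ≤ L := abs_nonneg _
    nlinarith
  obtain ⟨δ, hδ, hδ'⟩ := Metric.eventually_nhds_iff.1
    (hF.continuous.continuousAt.eventually_ne hF0)
  have hr : ∀ i : {ρ : ℂ // Complex.sin ρ - ρ - a = 0}, δ ≤ ‖(i : ℂ)‖ := by
    intro i
    by_contra! hi
    exact hδ' (by simpa using hi) i.2
  have hL0 : 0 ≤ L := abs_nonneg _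
  have hsR := aux_summable (fun i : {ρ : ℂ // Complex.sin ρ - ρ - a = 0} => (k i : ℝ))
    (fun i => ‖(i : ℂ)‖) (fun i => Nat.cast_nonneg _) hδ hr (by positivity) hcount
  have hs : Summable (fun ρ : {ρ : ℂ // Complex.sin ρ - ρ - a = 0} =>
      (k ρ : ℂ) / (ρ : ℂ) ^ 2) := by
    refine Summable.of_norm ?_
    simpa using hsR
  refine ⟨hs, ?_⟩
  have hk1 : ∀ i : {ρ : ℂ // Complex.sin ρ - ρ - a = 0}, (1 : ℝ) ≤ k i := by
    intro i
    have h1 := (hk i i.2).2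
    have : k i ≠ 0 := by
      intro h0
      rw [h0, Nat.cast_zero, (hF.analyticAt i).analyticOrderAt_eq_zero] at h1
      exact h1 i.2
    exact_mod_cast Nat.one_le_iff_ne_zero.2 this
  have hfin : ∀ R : ℝ, {i : {ρ : ℂ // Complex.sin ρ - ρ - a = 0} | ‖(i : ℂ)‖ ≤ R}.Finite := by
    intro R
    by_contra hinf
    obtain ⟨n, hn⟩ := exists_nat_gt ((6 + 2 * L) * (|R| + 1 + 1))
    obtain ⟨S, hS, hcard⟩ := Set.Infinite.exists_subset_card_eq hinf n
    have h1 := hcount S (|R| + 1) (by positivity) (fun i hi => by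
      have : ‖(i : ℂ)‖ ≤ R := hS hi
      linarith [le_abs_self R])
    have h2 : (n : ℝ) ≤ ∑ i ∈ S, (k i : ℝ) := by
      rw [← hcard]
      simpa using Finset.card_nsmul_le_sum S (fun i => (k i : ℝ)) 1 (fun i _ => hk1 i)
    linarith
  have htop : Filter.Tendsto (fun n : ℕ => (hfin n).toFinset) Filter.atTop Filter.atTop := by
    refine Filter.tendsto_atTop_finset_of_monotone ?_ ?_
    · intro m n hmn i hi
      simp only [Set.Finite.mem_toFinset, Set.mem_ofPred_eq] at hi ⊢
      exact hi.trans (by exact_mod_cast hmn)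
    · intro i
      obtain ⟨n, hn⟩ := exists_nat_ge ‖(i : ℂ)‖
      exact ⟨n, by simpa using hn⟩
  have hlim := hs.hasSum.comp htop
  refine tendsto_nhds_unique hlim ?_
  have hb : ∀ᶠ n : ℕ in Filter.atTop, ‖((fun S : Finset {ρ : ℂ // Complex.sin ρ - ρ - a = 0} =>
      ∑ i ∈ S, (k i : ℂ) / (i : ℂ) ^ 2) ∘ fun n : ℕ => (hfin n).toFinset) n‖ ≤
      (16 * (2 + L)) * (1 / (n : ℝ)) := by
    filter_upwards [Filter.eventually_ge_atTop 1] with n hn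
    have hn' : (1 : ℝ) ≤ n := by exact_mod_cast hn
    have h1 := aux_second hF k ((hfin n).toFinset.map (Function.Embedding.subtype _))
      (hSub _) (R := n) (by linarith) (by
        intro ρ hρ
        simp only [Finset.mem_map, Function.Embedding.subtype_apply, Set.Finite.mem_toFinset] at hρ
        obtain ⟨σ, h, rfl⟩ := hρ
        exact h) (by
        intro ρ hρ hle
        simp only [Finset.mem_map, Function.Embedding.subtype_apply, Set.Finite.mem_toFinset]
        exact ⟨⟨ρ, hρ⟩, hle, rfl⟩) hA hF0 hF2
    rw [Finset.sum_map] at h1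
    refine h1.trans ?_
    rw [mul_one_div, div_le_div_iff₀ (by positivity) (by positivity)]
    have : 2 * (n : ℝ) + L ≤ (2 + L) * n := by nlinarith
    calc 16 * (2 * (n : ℝ) + L) * n ≤ 16 * ((2 + L) * n) * n := by gcongr
      _ = _ := by ring
  refine squeeze_zero_norm' hb ?_
  simpa using tendsto_one_div_atTop_nhds_zero_nat.const_mul (16 * (2 + L))
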